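/- Fix a real α > 1. There is a constant C > 0 (depending only on α) such that for every real R ≥ 1 and every positive integer t with t ≤ R^{1/6}, the set S_{α,t}(R) = { ⌊j^α⌋/t : j ∈ ℕ, R < ⌊j^α⌋ ≤ 2R, t divides ⌊j^α⌋ } satisfies #S_{α,t}(R) ≤ C · ( R^{1/α}/t + R^{1/2} ). -/

import Mathlib

open scoped BigOperators Classical

/-- The set `S_{α,t}(R) = { ⌊j^α⌋/t : j ∈ ℕ, R < ⌊j^α⌋ ≤ 2R, t ∣ ⌊j^α⌋ }`
realised as a finite set of rationals. -/
noncomputable def PSdivSet (α : ℝ) (t : ℕ) (R : ℝ) : Finset ℚ :=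
  (((Finset.range (Nat.ceil ((2 * R + 1) ^ (1 / α)) + 1)).image
      (fun j : ℕ => (Nat.floor ((j : ℝ) ^ α) : ℕ))).filter
    (fun q : ℕ => R < (q : ℝ) ∧ (q : ℝ) ≤ 2 * R ∧ t ∣ q)).image
    (fun q : ℕ => (q : ℚ) / (t : ℚ))


lemma aux_dvd (s : ℚ) (a b : ℤ) (h : (a : ℚ) = s * b) : (s.den : ℤ) ∣ b := by
  have h1 : (a : ℚ) * s.den = s.num * b := by
    rw [h]
    have := Rat.mul_den_eq_num s
    calc s * b * s.den = (s * s.den) * b := by ring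
      _ = _ := by rw [this]
  have h2 : a * s.den = s.num * b := by exact_mod_cast h1
  have h3 : IsCoprime (s.den : ℤ) s.num := by
    rw [Int.isCoprime_iff_gcd_eq_one]
    have := s.reduced
    rw [Int.gcd_comm]
    simpa [Int.gcd, Nat.Coprime] using this
  exact h3.dvd_of_dvd_mul_left ⟨a, by rw [← h2]; ring⟩

lemma aux_gap (s : ℚ) (a b : ℤ) (h : (a : ℝ) - s * b > 0) :
    1 / (s.den : ℝ) ≤ (a : ℝ) - s * b := by
  have hd : (0 : ℝ) < s.den := by exact_mod_cast s.den_pos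
  have hs : (s : ℝ) * s.den = s.num := by exact_mod_cast Rat.mul_den_eq_num s
  have h1 : ((a : ℝ) - s * b) * s.den = ((a * s.den - s.num * b : ℤ) : ℝ) := by
    push_cast
    rw [← hs]; ring
  have h2 : 0 < ((a * s.den - s.num * b : ℤ) : ℝ) := by
    rw [← h1]; positivity
  have h3 : (1 : ℝ) ≤ ((a * s.den - s.num * b : ℤ) : ℝ) := by
    have : 0 < (a * s.den - s.num * b : ℤ) := by exact_mod_cast h2
    exact_mod_cast this
  rw [div_le_iff₀ hd, h1]
  exact h3

lemma aux_box (T : Finset ℚ) (Q : ℕ) (A B δ : ℝ) (hδ : δ ≤ 1)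
    (hAB : A ≤ B)
    (hT : ∀ s ∈ T, s.den ≤ Q ∧ A - δ / s.den ≤ (s : ℝ) ∧ (s : ℝ) ≤ B + δ / s.den)
    (w : ℕ → ℝ) (hw : ∀ q, 0 ≤ w q) :
    ∑ s ∈ T, w s.den ≤ ∑ q ∈ Finset.Icc 1 Q, ((q : ℝ) * (B - A) + 3) * w q := by
  have hm : ∀ s ∈ T, s.den ∈ Finset.Icc 1 Q := fun s hs =>
    Finset.mem_Icc.2 ⟨s.den_pos, (hT s hs).1⟩
  rw [← Finset.sum_fiberwise_of_maps_to hm]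
  apply Finset.sum_le_sum
  intro q hq
  have hq1 : (1 : ℝ) ≤ q := by exact_mod_cast (Finset.mem_Icc.1 hq).1
  have hc : ∑ s ∈ T with s.den = q, w s.den = ((T.filter (fun s => s.den = q)).card : ℝ) * w q := by
    rw [Finset.sum_congr rfl (g := fun _ => w q)]
    · simp
    · intro s hs
      rw [(Finset.mem_filter.1 hs).2]
  rw [hc]
  apply mul_le_mul_of_nonneg_right _ (hw q)
  have hcard : (T.filter (fun s => s.den = q)).card ≤
      (Finset.Icc ⌈q * A - 1⌉ ⌊q * B + 1⌋).card := by
    apply Finset.card_le_card_of_injOn (fun s : ℚ => s.num)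
    · intro s hs
      obtain ⟨hsT, hsq⟩ := Finset.mem_filter.1 hs
      obtain ⟨-, h1, h2⟩ := hT s hsT
      rw [hsq] at h1 h2
      have hs' : (s : ℝ) * q = s.num := by
        rw [← hsq]; exact_mod_cast Rat.mul_den_eq_num s
      have e1 : (A - δ / q) * q = A * q - δ := by field_simp
      have e2 : (B + δ / q) * q = B * q + δ := by field_simp
      have k1 : (A - δ / q) * q ≤ s * q := by gcongr
      have k2 : s * q ≤ (B + δ / q) * q := by gcongr
      simp only [Finset.coe_Icc, Set.mem_Icc]
      constructor
      · rw [Int.ceil_le]; linarith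
      · rw [Int.le_floor]; linarith
    · intro s hs s' hs' h
      have h1 := (Finset.mem_filter.1 hs).2
      have h2 := (Finset.mem_filter.1 hs').2
      exact Rat.ext h (h1.trans h2.symm)
  have h0 : (0 : ℝ) ≤ q * (B - A) := mul_nonneg (by linarith) (by linarith)
  have : ((Finset.Icc ⌈q * A - 1⌉ ⌊q * B + 1⌋).card : ℝ) ≤ q * (B - A) + 3 := by
    rw [Int.card_Icc]
    have h5 : (((⌊q * B + 1⌋ + 1 - ⌈q * A - 1⌉).toNat : ℤ) : ℝ) ≤ q * (B - A) + 3 := by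
      rw [Int.toNat_eq_max]
      push_cast
      apply max_le
      · have := Int.floor_le (q * B + 1)
        have := Int.le_ceil (q * A - 1)
        linarith
      · linarith
    exact_mod_cast h5
  exact le_trans (by exact_mod_cast hcard) this

structure Cfg (n : ℕ) (δ lam : ℝ) (x m : ℕ → ℤ) (F G : ℕ → ℝ) : Prop where
  mono : ∀ i j, i < j → j ≤ n → x i < x j
  lo : ∀ i, i ≤ n → (m i : ℝ) ≤ F i
  hi : ∀ i, i ≤ n → F i < m i + δ
  conv : ∀ i, i ≤ n → ∀ k, k ≤ n →
    F i + G i * (x k - x i) + lam / 2 * (x k - x i) ^ 2 ≤ F k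

noncomputable def sl (x m : ℕ → ℤ) (i : ℕ) : ℚ := (m (i+1) - m i : ℚ) / (x (i+1) - x i : ℚ)

section
variable {n : ℕ} {δ lam : ℝ} {x m : ℕ → ℤ} {F G : ℕ → ℝ}

lemma Cfg.sl_eq (h : Cfg n δ lam x m F G) {i : ℕ} (hi : i < n) :
    ((m (i+1) - m i : ℤ) : ℚ) = sl x m i * ((x (i+1) - x i : ℤ) : ℚ) := by
  have := h.mono i (i+1) (by omega) (by omega)
  have h2 : (x (i+1) - x i : ℚ) ≠ 0 := by
    have : (x i : ℚ) < x (i+1) := by exact_mod_cast this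
    linarith
  unfold sl
  push_cast
  field_simp

lemma Cfg.den_le (h : Cfg n δ lam x m F G) {i : ℕ} (hi : i < n) :
    ((sl x m i).den : ℤ) ≤ x (i+1) - x i := by
  have := h.mono i (i+1) (by omega) (by omega)
  exact Int.le_of_dvd (by omega) (aux_dvd _ _ _ (h.sl_eq hi))

lemma Cfg.sl_eqR (h : Cfg n δ lam x m F G) {i : ℕ} (hi : i < n) :
    (m (i+1) - m i : ℝ) = (sl x m i : ℝ) * (x (i+1) - x i) := by
  have := h.sl_eq hi
  have h2 : (((m (i+1) - m i : ℤ) : ℚ) : ℝ) = ((sl x m i * ((x (i+1) - x i : ℤ) : ℚ) : ℚ) : ℝ) := by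
    rw [this]
  push_cast at h2
  exact h2

lemma Cfg.sl_box (h : Cfg n δ lam x m F G) (hl : 0 ≤ lam) (hδ : 0 ≤ δ) {i : ℕ} (hi : i < n)
    {A B : ℝ} (hG : ∀ i ≤ n, A ≤ G i ∧ G i ≤ B) :
    A - δ / (sl x m i).den ≤ (sl x m i : ℝ) ∧ (sl x m i : ℝ) ≤ B + δ / (sl x m i).den := by
  have hd : (0 : ℝ) < (sl x m i).den := by exact_mod_cast (sl x m i).den_pos
  have hd2 : ((sl x m i).den : ℝ) ≤ x (i+1) - x i := by exact_mod_cast h.den_le hi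
  set a : ℝ := (x (i+1) : ℝ) - x i with ha
  have e := h.sl_eqR hi
  rw [← ha] at e
  have ha0 : 0 < a := by linarith
  have c1 := h.conv i (by omega) (i+1) (by omega)
  have c2 := h.conv (i+1) (by omega) i (by omega)
  rw [← ha] at c1
  have ha' : (x i : ℝ) - x (i+1) = -a := by rw [ha]; ring
  rw [ha'] at c2
  have := h.lo i (by omega)
  have := h.lo (i+1) (by omega)
  have := h.hi i (by omega)
  have := h.hi (i+1) (by omega)
  have g1 := (hG i (by omega)).1
  have g2 := (hG (i+1) (by omega)).2
  have p1 : 0 ≤ lam / 2 * a ^ 2 := by positivity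
  have p2 : 0 ≤ lam / 2 * (-a) ^ 2 := by positivity
  have k : δ / a ≤ δ / (sl x m i).den := by gcongr
  have q1 : A * a ≤ G i * a := by gcongr
  have q2 : G (i+1) * a ≤ B * a := by gcongr
  have e3 : δ / a * a = δ := by field_simp
  constructor
  · have : (A - δ / a) * a ≤ (sl x m i) * a := by linarith
    have := le_of_mul_le_mul_right this ha0
    linarith
  · have : (sl x m i) * a ≤ (B + δ / a) * a := by linarith
    have := le_of_mul_le_mul_right this ha0
    linarith

lemma Cfg.Gmono (h : Cfg n δ lam x m F G) (hl : 0 ≤ lam) {i j : ℕ} (hij : i ≤ j) (hj : j ≤ n) :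
    G i ≤ G j := by
  rcases hij.eq_or_lt with rfl | hij
  · exact le_rfl
  have hx : (x i : ℝ) < x j := by exact_mod_cast h.mono i j hij hj
  have c1 := h.conv i (by omega) j (by omega)
  have c2 := h.conv j (by omega) i (by omega)
  have p1 : 0 ≤ lam / 2 * ((x j : ℝ) - x i) ^ 2 := by positivity
  have p2 : 0 ≤ lam / 2 * ((x i : ℝ) - x j) ^ 2 := by positivity
  have : G i * (x j - x i) ≤ G j * (x j - x i) := by linarith
  exact le_of_mul_le_mul_right this (by linarith)

/-- a point `e` on the same line as `j`, to the right -/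
lemma Cfg.len1 (h : Cfg n δ lam x m F G) (s : ℚ) {j e : ℕ} (hj : j ≤ n) (he : e ≤ n)
    (hc : (m e : ℝ) - s * x e = m j - s * x j) :
    (G j - s) * (x e - x j) + lam / 2 * (x e - x j) ^ 2 ≤ δ := by
  have c1 := h.conv j hj e he
  have := h.lo j hj
  have := h.hi e he
  linarith

lemma Cfg.len2 (h : Cfg n δ lam x m F G) (hl : 0 ≤ lam) (s : ℚ) (hs : s.den * δ ≤ 1 / 2) {j : ℕ} (hj : j + 1 ≤ n)
    (hG : (s : ℝ) ≤ G j)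
    (hc : (m (j+1) : ℝ) - s * x (j+1) ≠ m j - s * x j) :
    1 / (2 * s.den) ≤ (G (j+1) - s) * (x (j+1) - x j) := by
  have hx : (x j : ℝ) < x (j+1) := by exact_mod_cast h.mono j (j+1) (by omega) hj
  have hd : (0 : ℝ) < s.den := by exact_mod_cast s.den_pos
  have c1 := h.conv j (by omega) (j+1) (by omega)
  have c2 := h.conv (j+1) (by omega) j (by omega)
  have p1 : 0 ≤ lam / 2 * ((x (j+1) : ℝ) - x j) ^ 2 := by positivity
  have p2 : 0 ≤ lam / 2 * ((x j : ℝ) - x (j+1)) ^ 2 := by positivity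
  have := h.lo j (by omega)
  have := h.lo (j+1) (by omega)
  have := h.hi j (by omega)
  have := h.hi (j+1) (by omega)
  have hp : 0 ≤ (G j - s) * (x (j+1) - x j) := mul_nonneg (by linarith) (by linarith)
  have hδ : δ ≤ 1 / (2 * s.den) := by
    rw [le_div_iff₀ (by positivity)]; linarith
  have hh : 1 / (s.den : ℝ) = 2 * (1 / (2 * s.den)) := by field_simp
  have hpos : 0 < 1 / (2 * (s.den : ℝ)) := by positivity
  rcases lt_or_gt_of_ne hc with hlt | hgt
  · have := aux_gap s (m j - m (j+1)) (x j - x (j+1)) (by push_cast; linarith)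
    push_cast at this
    exfalso
    linarith
  · have := aux_gap s (m (j+1) - m j) (x (j+1) - x j) (by push_cast; linarith)
    push_cast at this
    linarith
end

noncomputable def cc (x m : ℕ → ℤ) (i : ℕ) : ℚ := m i - sl x m i * x i

noncomputable def Rset (n Q : ℕ) (x m : ℕ → ℤ) (G : ℕ → ℝ) : Finset ℕ :=
  (Finset.range n).filter (fun i => (sl x m i).den ≤ Q ∧ (sl x m i : ℝ) ≤ G i)

noncomputable def Fib (n Q : ℕ) (x m : ℕ → ℤ) (G : ℕ → ℝ) (j : ℕ) : Finset ℕ :=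
  (Rset n Q x m G).filter (fun i => j ≤ i ∧ sl x m i = sl x m j ∧ cc x m i = cc x m j)

section
variable {n : ℕ} {δ lam : ℝ} {x m : ℕ → ℤ} {F G : ℕ → ℝ}

lemma Cfg.x_inj (h : Cfg n δ lam x m F G) {i j : ℕ} (hi : i ≤ n) (hj : j ≤ n) (e : x i = x j) :
    i = j := by
  rcases lt_trichotomy i j with hl | hl | hl
  · have := h.mono i j hl hj; omega
  · exact hl
  · have := h.mono j i hl hi; omega

/-- facts about a fibre element -/
lemma Cfg.fib_line (h : Cfg n δ lam x m F G) {Q j i : ℕ}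
    (hi : i ∈ Fib n Q x m G j) :
    ((m (i+1) - m j : ℤ) : ℚ) = sl x m j * ((x (i+1) - x j : ℤ) : ℚ) := by
  obtain ⟨hiR, hji, hs, hc⟩ := Finset.mem_filter.1 hi
  obtain ⟨hin, -⟩ := Finset.mem_filter.1 hiR
  have e := h.sl_eq (Finset.mem_range.1 hin)
  unfold cc at hc
  rw [hs] at e hc
  push_cast at e ⊢
  linarith

lemma Cfg.fib_card (h : Cfg n δ lam x m F G) {Q j : ℕ} (Bd : ℝ) (hB : 0 ≤ Bd)
    (hb : ∀ i ∈ Fib n Q x m G j, (x (i+1) - x j : ℝ) ≤ Bd * (sl x m j).den) :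
    ((Fib n Q x m G j).card : ℝ) ≤ Bd := by
  set q : ℤ := ((sl x m j).den : ℤ) with hq
  have hq0 : 0 < q := by rw [hq]; exact_mod_cast (sl x m j).den_pos
  have key : (Fib n Q x m G j).card ≤ (Finset.Icc (1:ℤ) ⌊Bd⌋).card := by
    apply Finset.card_le_card_of_injOn (fun i => (x (i+1) - x j) / q)
    · intro i hi
      have hd : q ∣ _ := aux_dvd _ _ _ (h.fib_line hi)
      obtain ⟨hiR, hji, hs, hc⟩ := Finset.mem_filter.1 hi
      obtain ⟨hin, -⟩ := Finset.mem_filter.1 hiR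
      have hin := Finset.mem_range.1 hin
      have hx := h.mono j (i+1) (by omega) (by omega)
      obtain ⟨c, hc⟩ := hd
      have hbi := hb i hi
      simp only [Finset.coe_Icc, Set.mem_Icc]
      rw [hc, Int.mul_ediv_cancel_left _ hq0.ne']
      constructor
      · by_contra hneg
        have : c ≤ 0 := by omega
        nlinarith
      · rw [Int.le_floor]
        have e1 : (x (i+1) - x j : ℝ) = q * c := by exact_mod_cast hc
        have e2 : ((sl x m j).den : ℝ) = q := by rw [hq]; norm_cast
        rw [e1, e2, mul_comm] at hbi
        exact le_of_mul_le_mul_right hbi (by exact_mod_cast hq0)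
    · intro i hi i' hi' e
      have hd : q ∣ _ := aux_dvd _ _ _ (h.fib_line hi)
      have hd' : q ∣ _ := aux_dvd _ _ _ (h.fib_line hi')
      have e := (Int.ediv_left_inj hd hd').1 e
      have hin := Finset.mem_range.1 (Finset.mem_filter.1 (Finset.mem_filter.1 hi).1).1
      have hin' := Finset.mem_range.1 (Finset.mem_filter.1 (Finset.mem_filter.1 hi').1).1
      have := h.x_inj (i := i+1) (j := i'+1) (by omega) (by omega) (by omega)
      omega
  have k2 : ((Finset.Icc (1:ℤ) ⌊Bd⌋).card : ℝ) ≤ Bd := by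
    rw [Int.card_Icc]
    have h0 : 0 ≤ ⌊Bd⌋ := Int.floor_nonneg.2 hB
    have : (((⌊Bd⌋ + 1 - 1).toNat : ℤ) : ℝ) ≤ Bd := by
      rw [Int.toNat_of_nonneg (by omega)]
      simpa using Int.floor_le Bd
    exact_mod_cast this
  exact le_trans (by exact_mod_cast key) k2

lemma Cfg.fib_L (h : Cfg n δ lam x m F G) (hl : 0 < lam) {Q j : ℕ} (hj : j ∈ Rset n Q x m G)
    {L : ℝ} (hL : 0 ≤ L) (hL2 : 2 * δ ≤ lam * L ^ 2) :
    ((Fib n Q x m G j).card : ℝ) ≤ L / (sl x m j).den := by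
  have hd : (0 : ℝ) < (sl x m j).den := by exact_mod_cast (sl x m j).den_pos
  apply h.fib_card _ (by positivity)
  intro i hi
  have hline := h.fib_line hi
  have hin := Finset.mem_range.1 (Finset.mem_filter.1 (Finset.mem_filter.1 hi).1).1
  have hji := (Finset.mem_filter.1 hi).2.1
  obtain ⟨hjn, -, hjG⟩ := Finset.mem_filter.1 hj
  have hlR : (m (i+1) - m j : ℝ) = sl x m j * (x (i+1) - x j) := by exact_mod_cast hline
  have hx : (x j : ℝ) < x (i+1) := by exact_mod_cast h.mono j (i+1) (by omega) (by omega)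
  have := h.len1 (sl x m j) (j := j) (e := i+1) (by omega) (by omega) (by linarith)
  have hp : 0 ≤ (G j - sl x m j) * (x (i+1) - x j) := mul_nonneg (by linarith) (by linarith)
  rw [div_mul_cancel₀ _ hd.ne']
  have : lam * (x (i+1) - x j : ℝ) ^ 2 ≤ lam * L ^ 2 := by linarith
  have := le_of_mul_le_mul_left this hl
  exact abs_le_of_sq_le_sq' this hL |>.2

lemma Cfg.fib_gap (h : Cfg n δ lam x m F G) (hl : 0 < lam) (hδ : 0 ≤ δ) {Q j : ℕ} (hQ : Q * δ ≤ 1 / 2)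
    (hj : j + 1 ∈ Rset n Q x m G)
    (hG : (sl x m (j+1) : ℝ) ≤ G j)
    (hst : ∀ i ∈ Rset n Q x m G, i < j + 1 → ¬ (sl x m i = sl x m (j+1) ∧ cc x m i = cc x m (j+1))) :
    ((Fib n Q x m G (j+1)).card : ℝ) ≤ 2 * δ * (x (j+1) - x j) := by
  obtain ⟨hjn, hjQ, hjG⟩ := Finset.mem_filter.1 hj
  have hjn := Finset.mem_range.1 hjn
  set s := sl x m (j+1) with hs
  have hd : (0 : ℝ) < s.den := by exact_mod_cast s.den_pos
  have hx : (x j : ℝ) < x (j+1) := by exact_mod_cast h.mono j (j+1) (by omega) (by omega)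
  have hne : (m (j+1) : ℝ) - s * x (j+1) ≠ m j - s * x j := by
    intro he
    have heQ : (m (j+1) : ℚ) - s * x (j+1) = m j - s * x j := by exact_mod_cast he
    have hxQ : (x j : ℚ) < x (j+1) := by exact_mod_cast hx
    have hsj : sl x m j = s := by
      unfold sl
      rw [div_eq_iff (by linarith)]
      linarith
    apply hst j _ (by omega)
    · refine ⟨hsj, ?_⟩
      unfold cc
      rw [hsj, ← hs]; exact heQ.symm
    · refine Finset.mem_filter.2 ⟨Finset.mem_range.2 (by omega), ?_, ?_⟩
      · rw [hsj]; exact hjQ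
      · rw [hsj]; exact hG
  have hsδ : s.den * δ ≤ 1 / 2 := by
    have : (s.den : ℝ) ≤ Q := by exact_mod_cast hjQ
    nlinarith
  have k := h.len2 hl.le s hsδ (j := j) (by omega) hG hne
  apply h.fib_card _ (by apply mul_nonneg <;> linarith)
  intro i hi
  have hline := h.fib_line hi
  rw [← hs] at hline ⊢
  have hin := Finset.mem_range.1 (Finset.mem_filter.1 (Finset.mem_filter.1 hi).1).1
  have hji := (Finset.mem_filter.1 hi).2.1
  have hlR : (m (i+1) - m (j+1) : ℝ) = s * (x (i+1) - x (j+1)) := by exact_mod_cast hline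
  have hxi : (x (j+1) : ℝ) < x (i+1) := by exact_mod_cast h.mono (j+1) (i+1) (by omega) (by omega)
  have k2 := h.len1 s (j := j+1) (e := i+1) (by omega) (by omega) (by linarith)
  have p1 : 0 ≤ lam / 2 * ((x (i+1) : ℝ) - x (j+1)) ^ 2 := by positivity
  set l : ℝ := (x (i+1) : ℝ) - x (j+1)
  set d : ℝ := (x (j+1) : ℝ) - x j
  have hl0 : 0 < l := by simp only [l]; linarith
  have hd0 : 0 < d := by simp only [d]; linarith
  have k3 : (G (j+1) - s) * l ≤ δ := by linarith
  have k4 : 1 / (2 * s.den) * l ≤ δ * d := by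
    calc 1 / (2 * s.den) * l ≤ (G (j+1) - s) * d * l := by gcongr
      _ = (G (j+1) - s) * l * d := by ring
      _ ≤ δ * d := by gcongr
  have e : 1 / (2 * s.den) * l = l / (2 * s.den) := by ring
  rw [e, div_le_iff₀ (by positivity)] at k4
  linarith

lemma Cfg.right_bound (h : Cfg n δ lam x m F G) (hl : 0 < lam) (hδ : 0 ≤ δ) (hδ1 : δ ≤ 1) {Q : ℕ}
    (hQ : Q * δ ≤ 1 / 2) {L A B : ℝ} (hL : 0 ≤ L) (hL2 : 2 * δ ≤ lam * L ^ 2) (hAB : A ≤ B)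
    (hG : ∀ i ≤ n, A ≤ G i ∧ G i ≤ B) :
    ((Rset n Q x m G).card : ℝ) ≤ 2 * δ * (x n - x 0) +
      ∑ q ∈ Finset.Icc 1 Q, ((q : ℝ) * (B - A) + 3) * (L / q) := by
  set R := Rset n Q x m G with hR
  set S := R.filter (fun j => ∀ i ∈ R, i < j → ¬ (sl x m i = sl x m j ∧ cc x m i = cc x m j)) with hS
  have hcov : R ⊆ S.biUnion (fun j => Fib n Q x m G j) := by
    intro i hi
    have hex : ∃ j, j ∈ R ∧ sl x m j = sl x m i ∧ cc x m j = cc x m i := ⟨i, hi, rfl, rfl⟩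
    obtain ⟨h1, h2, h3⟩ := Nat.find_spec hex
    refine Finset.mem_biUnion.2 ⟨Nat.find hex, Finset.mem_filter.2 ⟨h1, ?_⟩, ?_⟩
    · rintro k hk hlt ⟨e1, e2⟩
      exact Nat.find_min hex hlt ⟨hk, e1.trans h2, e2.trans h3⟩
    · exact Finset.mem_filter.2 ⟨hi, Nat.find_min' hex ⟨hi, rfl, rfl⟩, h2.symm, h3.symm⟩
  have hcard : (R.card : ℝ) ≤ ∑ j ∈ S, ((Fib n Q x m G j).card : ℝ) := by
    exact_mod_cast (Finset.card_le_card hcov).trans Finset.card_biUnion_le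
  set N : Finset ℕ := S.filter (fun j => 0 < j ∧ (sl x m j : ℝ) ≤ G (j-1)) with hN
  set E : Finset ℕ := S.filter (fun j => ¬ (0 < j ∧ (sl x m j : ℝ) ≤ G (j-1))) with hE
  have hsplit : ∑ j ∈ S, ((Fib n Q x m G j).card : ℝ) =
      ∑ j ∈ N, ((Fib n Q x m G j).card : ℝ) + ∑ j ∈ E, ((Fib n Q x m G j).card : ℝ) :=
    (Finset.sum_filter_add_sum_filter_not _ _ _).symm
  have hSn : ∀ j ∈ S, j < n := fun j hj =>
    Finset.mem_range.1 (Finset.mem_filter.1 (Finset.mem_filter.1 hj).1).1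
  have hNb : ∑ j ∈ N, ((Fib n Q x m G j).card : ℝ) ≤ 2 * δ * (x n - x 0) := by
    have h1 : ∑ j ∈ N, ((Fib n Q x m G j).card : ℝ) ≤ ∑ j ∈ N, 2 * δ * ((x j : ℝ) - x (j-1)) := by
      apply Finset.sum_le_sum
      intro j hj
      obtain ⟨hjS, hj0, hjG⟩ := Finset.mem_filter.1 hj
      obtain ⟨hjR, hjm⟩ := Finset.mem_filter.1 hjS
      obtain ⟨k, rfl⟩ : ∃ k, j = k + 1 := ⟨j - 1, by omega⟩
      exact h.fib_gap hl hδ hQ hjR hjG hjm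
    have hsub : N ⊆ (Finset.range n).image (fun i => i + 1) := by
      intro j hj
      obtain ⟨hjS, hj0, hjG⟩ := Finset.mem_filter.1 hj
      have := hSn j hjS
      exact Finset.mem_image.2 ⟨j - 1, Finset.mem_range.2 (by omega), by omega⟩
    have h2 : ∑ j ∈ N, 2 * δ * ((x j : ℝ) - x (j-1)) ≤
        ∑ j ∈ (Finset.range n).image (fun i => i + 1), 2 * δ * ((x j : ℝ) - x (j-1)) := by
      apply Finset.sum_le_sum_of_subset_of_nonneg hsub
      intro j hj _
      obtain ⟨i, hi, rfl⟩ := Finset.mem_image.1 hj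
      have hi := Finset.mem_range.1 hi
      have hx : (x i : ℝ) < x (i+1) := by exact_mod_cast h.mono i (i+1) (by omega) (by omega)
      simp only [Nat.add_sub_cancel]
      apply mul_nonneg <;> linarith
    rw [Finset.sum_image (by intro a _ b _ e; simpa using e)] at h2
    simp only [Nat.add_sub_cancel] at h2
    rw [← Finset.mul_sum (Finset.range n), Finset.sum_range_sub (fun i => (x i : ℝ))] at h2
    linarith
  have hEb : ∑ j ∈ E, ((Fib n Q x m G j).card : ℝ) ≤
      ∑ q ∈ Finset.Icc 1 Q, ((q : ℝ) * (B - A) + 3) * (L / q) := by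
    have h1 : ∑ j ∈ E, ((Fib n Q x m G j).card : ℝ) ≤ ∑ j ∈ E, L / (sl x m j).den := by
      apply Finset.sum_le_sum
      intro j hj
      exact h.fib_L hl (Finset.mem_filter.1 (Finset.mem_filter.1 hj).1).1 hL hL2
    have hinj : ∀ a ∈ E, ∀ b ∈ E, a < b → sl x m a ≠ sl x m b := by
      intro a ha b hb hab e
      obtain ⟨haS, ha2⟩ := Finset.mem_filter.1 ha
      obtain ⟨hbS, hb2⟩ := Finset.mem_filter.1 hb
      apply hb2
      refine ⟨by omega, ?_⟩
      rw [← e]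
      have := (Finset.mem_filter.1 (Finset.mem_filter.1 haS).1).2.2
      have hbn := hSn b hbS
      exact this.trans (h.Gmono hl.le (by omega) (by omega))
    have h2 : ∑ j ∈ E, L / (sl x m j).den = ∑ s ∈ E.image (sl x m), L / (s.den : ℝ) := by
      rw [Finset.sum_image]
      intro a ha b hb e
      rcases lt_trichotomy a b with hab | hab | hab
      · exact absurd e (hinj a ha b hb hab)
      · exact hab
      · exact absurd e.symm (hinj b hb a ha hab)
    have h3 := aux_box (E.image (sl x m)) Q A B δ hδ1 hAB (by
      intro s hs
      obtain ⟨j, hj, rfl⟩ := Finset.mem_image.1 hs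
      have hjR := (Finset.mem_filter.1 (Finset.mem_filter.1 hj).1).1
      obtain ⟨hjn, hjQ, -⟩ := Finset.mem_filter.1 hjR
      exact ⟨hjQ, h.sl_box hl.le hδ (Finset.mem_range.1 hjn) hG⟩) (fun q => L / q)
        (fun q => by positivity)
    linarith
  linarith

lemma Cfg.refl' (h : Cfg n δ lam x m F G) :
    Cfg n δ lam (fun i => - x (n - i)) (fun i => m (n - i)) (fun i => F (n - i))
      (fun i => - G (n - i)) where
  mono i j hij hj := by
    have := h.mono (n - j) (n - i) (by omega) (by omega)
    show - x (n - i) < - x (n - j)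
    omega
  lo i hi := h.lo _ (by omega)
  hi i hi := h.hi _ (by omega)
  conv i hi k hk := by
    have := h.conv (n - i) (by omega) (n - k) (by omega)
    push_cast
    calc _ = _ := by ring
      _ ≤ _ := this

lemma sl_refl (i : ℕ) (hi : i < n) :
    sl (fun i => - x (n - i)) (fun i => m (n - i)) (n - 1 - i) = - sl x m i := by
  unfold sl
  have e1 : n - (n - 1 - i + 1) = i := by omega
  have e2 : n - (n - 1 - i) = i + 1 := by omega
  simp only [e1, e2]
  push_cast
  rw [← neg_div]
  congr 1 <;> ring

lemma Cfg.main (h : Cfg n δ lam x m F G) (hl : 0 < lam) (hδ : 0 ≤ δ) (hδ1 : δ ≤ 1) {Q : ℕ}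
    (hQ : Q * δ ≤ 1 / 2) {L A B : ℝ} (hL : 0 ≤ L) (hL2 : 2 * δ ≤ lam * L ^ 2) (hAB : A ≤ B)
    (hG : ∀ i ≤ n, A ≤ G i ∧ G i ≤ B) :
    (n : ℝ) ≤ (x n - x 0) / (Q + 1) + ∑ q ∈ Finset.Icc 1 Q, ((q : ℝ) * (B - A) + 3)
     + 2 * (2 * δ * (x n - x 0) +
      ∑ q ∈ Finset.Icc 1 Q, ((q : ℝ) * (B - A) + 3) * (L / q)) := by
  have hR := h.right_bound hl hδ hδ1 hQ hL hL2 hAB hG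
  have hR' := h.refl'.right_bound hl hδ hδ1 hQ hL hL2 (A := -B) (B := -A) (by linarith) (by
    intro i hi
    have := hG (n - i) (by omega)
    constructor <;> linarith)
  have e1 : ((- x (n - n) : ℤ) : ℝ) - ((- x (n - 0) : ℤ) : ℝ) = x n - x 0 := by
    simp; ring
  have e2 : -A - -B = B - A := by ring
  rw [e1, e2] at hR'
  set R' := Rset n Q (fun i => - x (n - i)) (fun i => m (n - i)) (fun i => - G (n - i)) with hR'def
  set Bg := (Finset.range n).filter (fun i => Q < (sl x m i).den) with hBg
  set St := (Finset.range n).filter (fun i => (sl x m i).den ≤ Q ∧ G i < sl x m i ∧ sl x m i < G (i+1)) with hSt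
  have hcov : Finset.range n ⊆ ((Bg ∪ St) ∪ Rset n Q x m G) ∪ R'.image (fun i => n - 1 - i) := by
    intro i hi
    have hin := Finset.mem_range.1 hi
    by_cases h1 : Q < (sl x m i).den
    · simp [hBg, h1, hin]
    push Not at h1
    by_cases h2 : (sl x m i : ℝ) ≤ G i
    · simp [Rset, h1, h2, hin]
    push Not at h2
    by_cases h3 : (sl x m i : ℝ) < G (i+1)
    · simp [hSt, h1, h2, h3, hin]
    push Not at h3
    apply Finset.mem_union_right
    refine Finset.mem_image.2 ⟨n - 1 - i, Finset.mem_filter.2 ⟨Finset.mem_range.2 (by omega), ?_⟩, by omega⟩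
    rw [sl_refl i hin]
    refine ⟨by simpa using h1, ?_⟩
    have e2 : n - (n - 1 - i) = i + 1 := by omega
    simp only [e2]
    push_cast
    linarith
  have hc : (n : ℝ) ≤ Bg.card + St.card + (Rset n Q x m G).card + R'.card := by
    have := Finset.card_le_card hcov
    rw [Finset.card_range] at this
    have k1 := Finset.card_union_le ((Bg ∪ St) ∪ Rset n Q x m G) (R'.image (fun i => n - 1 - i))
    have k2 := Finset.card_union_le (Bg ∪ St) (Rset n Q x m G)
    have k3 := Finset.card_union_le Bg St
    have k4 : (R'.image (fun i => n - 1 - i)).card ≤ R'.card := Finset.card_image_le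
    have : n ≤ Bg.card + St.card + (Rset n Q x m G).card + R'.card := by omega
    exact_mod_cast this
  have hBgb : (Bg.card : ℝ) ≤ (x n - x 0) / (Q + 1) := by
    rw [le_div_iff₀ (by positivity)]
    have h1 : ∑ i ∈ Bg, ((Q : ℝ) + 1) ≤ ∑ i ∈ Bg, ((x (i+1) : ℝ) - x i) := by
      apply Finset.sum_le_sum
      intro i hi
      obtain ⟨hin, hq⟩ := Finset.mem_filter.1 hi
      have := h.den_le (Finset.mem_range.1 hin)
      have : (Q : ℤ) + 1 ≤ x (i+1) - x i := by omega
      exact_mod_cast this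
    have h2 : ∑ i ∈ Bg, ((x (i+1) : ℝ) - x i) ≤ ∑ i ∈ Finset.range n, ((x (i+1) : ℝ) - x i) := by
      apply Finset.sum_le_sum_of_subset_of_nonneg (Finset.filter_subset _ _)
      intro i hi _
      have hi := Finset.mem_range.1 hi
      have hx : (x i : ℝ) < x (i+1) := by exact_mod_cast h.mono i (i+1) (by omega) (by omega)
      linarith
    rw [Finset.sum_range_sub (fun i => (x i : ℝ))] at h2
    simp only [Finset.sum_const, nsmul_eq_mul] at h1
    linarith
  have hStb : (St.card : ℝ) ≤ ∑ q ∈ Finset.Icc 1 Q, ((q : ℝ) * (B - A) + 3) := by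
    have hinj : ∀ a ∈ St, ∀ b ∈ St, a < b → sl x m a ≠ sl x m b := by
      intro a ha b hb hab e
      obtain ⟨hbn, -, hb2, -⟩ := Finset.mem_filter.1 hb
      obtain ⟨-, -, -, ha2⟩ := Finset.mem_filter.1 ha
      have hbn := Finset.mem_range.1 hbn
      have := h.Gmono hl.le (i := a+1) (j := b) (by omega) (by omega)
      rw [e] at ha2
      linarith
    have h2 : (St.image (sl x m)).card = St.card := by
      apply Finset.card_image_of_injOn
      intro a ha b hb e
      rcases lt_trichotomy a b with hab | hab | hab
      · exact absurd e (hinj a ha b hb hab)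
      · exact hab
      · exact absurd e.symm (hinj b hb a ha hab)
    have h3 := aux_box (St.image (sl x m)) Q A B δ hδ1 hAB (by
      intro s hs
      obtain ⟨j, hj, rfl⟩ := Finset.mem_image.1 hs
      obtain ⟨hjn, hjQ, -⟩ := Finset.mem_filter.1 hj
      exact ⟨hjQ, h.sl_box hl.le hδ (Finset.mem_range.1 hjn) hG⟩) (fun q => 1)
        (fun q => by positivity)
    simp only [Finset.sum_const, nsmul_eq_mul, mul_one] at h3
    rw [← h2]; exact h3
  linarith
end

lemma tangent (α X : ℝ) (hα : 1 < α) (hα2 : α < 2) (hX : 0 < X) (x y : ℝ) (hx : 0 < x) (hxX : x ≤ X)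
    (hy : 0 < y) (hyX : y ≤ X) :
    x ^ α + α * x ^ (α - 1) * (y - x) + α * (α - 1) * X ^ (α - 2) / 2 * (y - x) ^ 2 ≤ y ^ α := by
  set c := α * (α - 1) * X ^ (α - 2) with hc
  have hD : ∀ z ∈ Set.Ioc 0 X, HasDerivAt (fun z : ℝ => z ^ α - c / 2 * z ^ 2) (α * z ^ (α - 1) - c * z) z := by
    intro z hz
    have h1 := Real.hasDerivAt_rpow_const (x := z) (p := α) (Or.inl hz.1.ne')
    have h2 := ((hasDerivAt_id z).pow 2).const_mul (c / 2)
    have h3 := h1.sub h2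
    refine h3.congr_deriv ?_
    simp; ring
  have hD2 : ∀ z ∈ Set.Ioc 0 X, HasDerivAt (fun z : ℝ => α * z ^ (α - 1) - c * z) (α * ((α - 1) * z ^ (α - 1 - 1)) - c) z := by
    intro z hz
    have h1 := (Real.hasDerivAt_rpow_const (x := z) (p := α - 1) (Or.inl hz.1.ne')).const_mul α
    have h2 := (hasDerivAt_id z).const_mul c
    have h3 := h1.sub h2
    refine h3.congr_deriv ?_
    simp
  have hmono : MonotoneOn (fun z : ℝ => α * z ^ (α - 1) - c * z) (Set.Ioc 0 X) := by
    apply monotoneOn_of_deriv_nonneg (convex_Ioc 0 X)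
    · intro z hz; exact (hD2 z hz).continuousAt.continuousWithinAt
    · intro z hz; exact (hD2 z (interior_subset hz)).differentiableAt.differentiableWithinAt
    · intro z hz
      have hz := interior_subset hz
      rw [(hD2 z hz).deriv]
      have : X ^ (α - 2) ≤ z ^ (α - 2) := Real.rpow_le_rpow_of_nonpos hz.1 hz.2 (by linarith)
      have e : α - 1 - 1 = α - 2 := by ring
      rw [e, hc]
      have : 0 ≤ α * (α - 1) * (z ^ (α - 2) - X ^ (α - 2)) :=
        mul_nonneg (mul_nonneg (by linarith) (by linarith)) (by linarith)
      linarith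
  have hconv : ConvexOn ℝ (Set.Ioc 0 X) (fun z : ℝ => z ^ α - c / 2 * z ^ 2) := by
    apply MonotoneOn.convexOn_of_deriv (convex_Ioc 0 X)
    · intro z hz; exact (hD z hz).continuousAt.continuousWithinAt
    · intro z hz; exact (hD z (interior_subset hz)).differentiableAt.differentiableWithinAt
    · intro a ha b hb hab
      rw [(hD a (interior_subset ha)).deriv, (hD b (interior_subset hb)).deriv]
      exact hmono (interior_subset ha) (interior_subset hb) hab
  rcases lt_trichotomy x y with hlt | rfl | hlt
  · have := hconv.le_slope_of_hasDerivAt ⟨hx, hxX⟩ ⟨hy, hyX⟩ hlt (hD x ⟨hx, hxX⟩)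
    rw [slope_def_field, le_div_iff₀ (by linarith)] at this
    linarith
  · simp
  · have := hconv.slope_le_of_hasDerivAt ⟨hy, hyX⟩ ⟨hx, hxX⟩ hlt (hD x ⟨hx, hxX⟩)
    rw [slope_def_field, div_le_iff₀ (by linarith)] at this
    linarith

lemma numeric (α X t D : ℝ) (n : ℕ) (hα : 1 < α) (hα2 : α < 2) (hX : 1 ≤ X) (ht : 1 ≤ t) (hDX : D ≤ X)
    (Q : ℕ) (hQ : Q = ⌊min t (X ^ (1 - α / 2)) / 2⌋₊)
    (K : ℝ) (hK : 0 ≤ K)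
    (h : (n : ℝ) ≤ D / (Q + 1) + ∑ q ∈ Finset.Icc 1 Q, ((q : ℝ) * (α * X ^ (α - 1) / t - 0) + 3)
     + 2 * (2 * (1 / t) * D +
      ∑ q ∈ Finset.Icc 1 Q, ((q : ℝ) * (α * X ^ (α - 1) / t - 0) + 3) * (K * X ^ (1 - α / 2) / q))) :
    (n : ℝ) + 1 ≤ 6 * (X / t) + (6 + α + 2 * α * K + 6 * K * (1 + 1 / (α - 1))) * X ^ (α / 2) := by
  have hX0 : 0 < X := by linarith
  set Z := X ^ (1 - α / 2) with hZ
  set Y := X ^ (α / 2) with hY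
  set W := X ^ (α - 1) with hW
  have hZ0 : 0 < Z := Real.rpow_pos_of_pos hX0 _
  have hY0 : 0 < Y := Real.rpow_pos_of_pos hX0 _
  have hW1 : 1 ≤ W := Real.one_le_rpow hX (by linarith)
  have hY1 : 1 ≤ Y := Real.one_le_rpow hX (by linarith)
  have hYZ : Y * Z = X := by
    rw [hY, hZ, ← Real.rpow_add hX0]; ring_nf; exact Real.rpow_one X
  have hZW : Z * W = Y := by
    rw [hZ, hW, hY, ← Real.rpow_add hX0]; ring_nf
  have hZY : Z ≤ Y := by rw [← hZW]; nlinarith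
  have hZX : Z ≤ X := by rw [← hYZ]; nlinarith
  set H := min t Z / 2 with hH
  have hH0 : 0 < H := by simp only [hH]; have : 0 < min t Z := lt_min (by linarith) hZ0
                         linarith
  have hHt : H ≤ t / 2 := by have := min_le_left t Z; simp only [hH]; linarith
  have hHZ : H ≤ Z / 2 := by have := min_le_right t Z; simp only [hH]; linarith
  have hQH : (Q : ℝ) ≤ H := by rw [hQ]; exact Nat.floor_le hH0.le
  have hQH1 : H < Q + 1 := by rw [hQ]; exact Nat.lt_floor_add_one H
  have hQ0 : (0 : ℝ) ≤ Q := Nat.cast_nonneg Q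
  have t0 : 0 < t := by linarith
  -- first term
  have b1 : D / (Q + 1) ≤ 2 * (X / t) + 2 * Y := by
    have h1 : D / (Q + 1) ≤ X / H := by
      calc D / (Q + 1) ≤ X / (Q + 1) := by gcongr
        _ ≤ X / H := by gcongr
    have h2 : X / H ≤ 2 * (X / t) + 2 * Y := by
      rcases min_choice t Z with hm | hm
      · have : X / H = 2 * (X / t) := by rw [hH, hm]; field_simp
        linarith
      · have : X / H = 2 * Y := by rw [hH, hm, ← hYZ]; field_simp
        have : 0 ≤ X / t := by positivity
        linarith
    linarith
  have hV : 0 ≤ α * W / t := by positivity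
  have b2 : ∑ q ∈ Finset.Icc 1 Q, ((q : ℝ) * (α * W / t - 0) + 3) ≤ α * Y + 3 * Y := by
    have h1 : ∑ q ∈ Finset.Icc 1 Q, ((q : ℝ) * (α * W / t - 0) + 3) ≤
        ∑ q ∈ Finset.Icc 1 Q, ((Q : ℝ) * (α * W / t) + 3) := by
      apply Finset.sum_le_sum
      intro q hq
      have : (q : ℝ) ≤ Q := by exact_mod_cast (Finset.mem_Icc.1 hq).2
      rw [sub_zero]
      gcongr
    simp only [Finset.sum_const, Nat.card_Icc, Nat.add_sub_cancel, nsmul_eq_mul] at h1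
    have h2 : (Q : ℝ) * (Q * (α * W / t)) ≤ Z * (t * (α * W / t)) := by
      gcongr <;> linarith
    have h3 : Z * (t * (α * W / t)) = α * Y := by rw [← hZW]; field_simp
    have : (Q : ℝ) ≤ Y := by linarith
    linarith
  have b3 : 2 * (1 / t) * D ≤ 2 * (X / t) := by
    calc 2 * (1 / t) * D ≤ 2 * (1 / t) * X := by gcongr
      _ = _ := by ring
  have b4 : ∑ q ∈ Finset.Icc 1 Q, ((q : ℝ) * (α * W / t - 0) + 3) * (K * Z / q) ≤
      α * K * Y + 3 * K * (1 + 1 / (α - 1)) * Y := by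
    have h1 : ∑ q ∈ Finset.Icc 1 Q, ((q : ℝ) * (α * W / t - 0) + 3) * (K * Z / q) =
        Q * ((α * W / t) * (K * Z)) + 3 * K * Z * ∑ q ∈ Finset.Icc 1 Q, (q : ℝ)⁻¹ := by
      rw [Finset.mul_sum]
      have : (Q : ℝ) * ((α * W / t) * (K * Z)) = ∑ q ∈ Finset.Icc 1 Q, (α * W / t) * (K * Z) := by
        simp
      rw [this, ← Finset.sum_add_distrib]
      apply Finset.sum_congr rfl
      intro q hq
      have : (q : ℝ) ≠ 0 := by
        have := (Finset.mem_Icc.1 hq).1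
        positivity
      field_simp
      ring
    have h2 : ∑ q ∈ Finset.Icc 1 Q, (q : ℝ)⁻¹ ≤ 1 + Real.log Q := by
      have := harmonic_le_one_add_log Q
      rw [harmonic_eq_sum_Icc] at this
      push_cast at this
      exact this
    have h3 : Real.log Q ≤ W / (α - 1) := by
      rcases Nat.eq_zero_or_pos Q with h0 | h0
      · rw [h0]; simp
        exact div_nonneg (by linarith) (by linarith)
      · have : Real.log Q ≤ Real.log X := Real.log_le_log (by exact_mod_cast h0) (by linarith)
        exact this.trans (Real.log_le_rpow_div hX0.le (by linarith))
    have h4 : ∑ q ∈ Finset.Icc 1 Q, (q : ℝ)⁻¹ ≤ (1 + 1 / (α - 1)) * W := by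
      have : W / (α - 1) = 1 / (α - 1) * W := by ring
      linarith
    have h5 : 3 * K * Z * ∑ q ∈ Finset.Icc 1 Q, (q : ℝ)⁻¹ ≤ 3 * K * Z * ((1 + 1 / (α - 1)) * W) := by
      gcongr
    have h6 : 3 * K * Z * ((1 + 1 / (α - 1)) * W) = 3 * K * (1 + 1 / (α - 1)) * Y := by
      rw [← hZW]; ring
    have h7 : Q * ((α * W / t) * (K * Z)) ≤ t * ((α * W / t) * (K * Z)) := by
      gcongr; linarith
    have h8 : t * ((α * W / t) * (K * Z)) = α * K * Y := by
      rw [← hZW]; field_simp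
    linarith
  linarith

lemma core (α : ℝ) (hα : 1 < α) (hα2 : α < 2) (X : ℝ) (hX : 1 ≤ X) (t : ℕ) (ht : 0 < t)
    (J : Finset ℕ) (hJ : ∀ j ∈ J, 1 ≤ j ∧ (j : ℝ) ≤ X ∧ t ∣ ⌊(j : ℝ) ^ α⌋₊) :
    (J.card : ℝ) ≤ 6 * (X / t) + (6 + α + 2 * α * √(2 / (α * (α - 1))) +
      6 * √(2 / (α * (α - 1))) * (1 + 1 / (α - 1))) * X ^ (α / 2) := by
  set K := √(2 / (α * (α - 1))) with hK
  have hα1 : 0 < α - 1 := by linarith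
  have hX0 : 0 < X := by linarith
  have ht1 : (1 : ℝ) ≤ t := by exact_mod_cast ht
  have ht0 : (0 : ℝ) < t := by linarith
  have hK2 : K ^ 2 = 2 / (α * (α - 1)) := Real.sq_sqrt (by positivity)
  have hK0 : 0 ≤ K := Real.sqrt_nonneg _
  rcases Nat.eq_zero_or_pos J.card with h0 | h0
  · rw [h0, Nat.cast_zero]; positivity
  obtain ⟨n, hn⟩ : ∃ n, J.card = n + 1 := ⟨J.card - 1, by omega⟩
  rw [hn]
  push_cast
  set y : ℕ → ℕ := fun i => if h : i < n + 1 then J.orderEmbOfFin hn ⟨i, h⟩ else 0 with hy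
  have hyJ : ∀ i, i ≤ n → y i ∈ J := by
    intro i hi
    simp only [hy, dif_pos (Nat.lt_succ_of_le hi)]
    exact J.orderEmbOfFin_mem hn _
  have hymono : ∀ i j, i < j → j ≤ n → y i < y j := by
    intro i j hij hj
    simp only [hy, dif_pos (Nat.lt_succ_of_le hj), dif_pos (show i < n + 1 by omega)]
    exact (J.orderEmbOfFin hn).strictMono (by simpa using hij)
  have hy1 : ∀ i, i ≤ n → (0 : ℝ) < y i := fun i hi => by
    have := (hJ _ (hyJ i hi)).1
    exact_mod_cast this
  have hyX : ∀ i, i ≤ n → (y i : ℝ) ≤ X := fun i hi => (hJ _ (hyJ i hi)).2.1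
  have hmt : ∀ i, i ≤ n → (((⌊(y i : ℝ) ^ α⌋₊ / t : ℕ) : ℤ) : ℝ) = (⌊(y i : ℝ) ^ α⌋₊ : ℝ) / t := by
    intro i hi
    rw [Int.cast_natCast, Nat.cast_div (hJ _ (hyJ i hi)).2.2 ht0.ne']
  have cfg : Cfg n (1 / (t : ℝ)) (α * (α - 1) * X ^ (α - 2) / t) (fun i => (y i : ℤ))
      (fun i => ((⌊(y i : ℝ) ^ α⌋₊ / t : ℕ) : ℤ)) (fun i => (y i : ℝ) ^ α / t)
      (fun i => α * (y i : ℝ) ^ (α - 1) / t) := by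
    refine ⟨?_, ?_, ?_, ?_⟩
    · intro i j hij hj
      exact_mod_cast hymono i j hij hj
    · intro i hi
      rw [hmt i hi]
      gcongr
      exact Nat.floor_le (by positivity)
    · intro i hi
      rw [hmt i hi, ← add_div]
      gcongr
      exact Nat.lt_floor_add_one _
    · intro i hi k hk
      have := tangent α X hα hα2 hX0 (y i) (y k) (hy1 i hi) (hyX i hi) (hy1 k hk) (hyX k hk)
      push_cast
      calc _ = ((y i : ℝ) ^ α + α * (y i : ℝ) ^ (α - 1) * (y k - y i) + α * (α - 1) * X ^ (α - 2) / 2 * (y k - y i) ^ 2) / t := by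
            field_simp
        _ ≤ _ := by gcongr
  set Q := ⌊min (t : ℝ) (X ^ (1 - α / 2)) / 2⌋₊ with hQ
  have hZ0 : 0 < X ^ (1 - α / 2) := Real.rpow_pos_of_pos hX0 _
  have hQt : (Q : ℝ) ≤ t / 2 := by
    have h1 : (Q : ℝ) ≤ min (t : ℝ) (X ^ (1 - α / 2)) / 2 := Nat.floor_le (by positivity)
    have := min_le_left (t : ℝ) (X ^ (1 - α / 2))
    linarith
  have hm := cfg.main (Q := Q) (L := K * X ^ (1 - α / 2)) (A := 0) (B := α * X ^ (α - 1) / t)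
    (by positivity) (by positivity) (by rw [div_le_one ht0]; exact ht1)
    (by
      rw [mul_one_div, div_le_iff₀ ht0]; linarith)
    (by positivity)
    (by
      rw [mul_pow, hK2, ← Real.rpow_natCast (X ^ (1 - α / 2)), ← Real.rpow_mul hX0.le]
      have e : X ^ ((1 - α / 2) * ((2 : ℕ) : ℝ)) = (X ^ (α - 2))⁻¹ := by
        rw [← Real.rpow_neg hX0.le]; congr 1; push_cast; ring
      rw [e]
      have : 0 < X ^ (α - 2) := Real.rpow_pos_of_pos hX0 _
      apply le_of_eq
      field_simp)
    (by positivity)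
    (by
      intro i hi
      have := hy1 i hi
      have := hyX i hi
      constructor
      · positivity
      · have : (y i : ℝ) ^ (α - 1) ≤ X ^ (α - 1) := Real.rpow_le_rpow (by positivity) (hyX i hi) hα1.le
        gcongr)
  refine numeric α X t _ n hα hα2 hX ht1 ?_ Q hQ K hK0 hm
  have := hyX n le_rfl
  have := hy1 0 (by omega)
  push_cast
  linarith

theorem card_PS_divisible (α : ℝ) (hα : 1 < α) :
    ∃ C : ℝ, 0 < C ∧ ∀ R : ℝ, 1 ≤ R → ∀ t : ℕ, 0 < t → (t : ℝ) ≤ R ^ ((1 : ℝ) / 6) →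
      ((PSdivSet α t R).card : ℝ) ≤ C * (R ^ (1 / α) / (t : ℝ) + R ^ ((1 : ℝ) / 2)) := by
  set K0 := 6 + α + 2 * α * √(2 / (α * (α - 1))) +
      6 * √(2 / (α * (α - 1))) * (1 + 1 / (α - 1)) with hK0
  have hα1 : 0 < α - 1 := by linarith
  have hK6 : 6 ≤ K0 := by
    have : 0 ≤ α + 2 * α * √(2 / (α * (α - 1))) +
      6 * √(2 / (α * (α - 1))) * (1 + 1 / (α - 1)) := by positivity
    linarith
  refine ⟨3 * K0, by positivity, ?_⟩
  intro R hR t ht _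
  have hR0 : 0 < R := by linarith
  have ht0 : (0 : ℝ) < t := by exact_mod_cast ht
  set X := (3 * R) ^ (1 / α) with hX
  have hX1 : 1 ≤ X := Real.one_le_rpow (by linarith) (by positivity)
  have hX3 : X ≤ 3 * R ^ (1 / α) := by
    rw [hX, Real.mul_rpow (by norm_num) hR0.le]
    gcongr
    calc (3 : ℝ) ^ (1 / α) ≤ 3 ^ (1 : ℝ) := by
          apply Real.rpow_le_rpow_of_exponent_le (by norm_num)
          rw [div_le_one (by linarith)]; linarith
      _ = 3 := Real.rpow_one 3
  have hY : (3 * R) ^ ((1 : ℝ) / 2) ≤ 3 * R ^ ((1 : ℝ) / 2) := by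
    rw [Real.mul_rpow (by norm_num) hR0.le]
    gcongr
    calc (3 : ℝ) ^ ((1 : ℝ) / 2) ≤ 3 ^ (1 : ℝ) := by
          apply Real.rpow_le_rpow_of_exponent_le (by norm_num)
          norm_num
      _ = 3 := Real.rpow_one 3
  have hXY : X ^ (α / 2) = (3 * R) ^ ((1 : ℝ) / 2) := by
    rw [hX, ← Real.rpow_mul (by positivity)]
    congr 1
    field_simp
  set J : Finset ℕ := (Finset.range (Nat.ceil ((2 * R + 1) ^ (1 / α)) + 1)).filter
    (fun j : ℕ => R < (⌊(j : ℝ) ^ α⌋₊ : ℝ) ∧ (⌊(j : ℝ) ^ α⌋₊ : ℝ) ≤ 2 * R ∧ t ∣ ⌊(j : ℝ) ^ α⌋₊) with hJdef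
  have hcard : (PSdivSet α t R).card ≤ J.card := by
    unfold PSdivSet
    refine Finset.card_image_le.trans ?_
    rw [Finset.filter_image]
    exact Finset.card_image_le
  have hJ : ∀ j ∈ J, 1 ≤ j ∧ (j : ℝ) ≤ X ∧ t ∣ ⌊(j : ℝ) ^ α⌋₊ := by
    intro j hj
    obtain ⟨-, h1, h2, h3⟩ := Finset.mem_filter.1 hj
    refine ⟨?_, ?_, h3⟩
    · by_contra hlt
      have : j = 0 := by omega
      subst this
      rw [Nat.cast_zero, Real.zero_rpow (by linarith)] at h1
      simp at h1
      linarith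
    · have h4 := Nat.lt_floor_add_one ((j : ℝ) ^ α)
      have h5 : (j : ℝ) ^ α ≤ 3 * R := by linarith
      have h6 : ((j : ℝ) ^ α) ^ (1 / α) ≤ X := Real.rpow_le_rpow (by positivity) h5 (by positivity)
      rwa [← Real.rpow_mul (by positivity), mul_one_div_cancel (by linarith), Real.rpow_one] at h6
  have hcardR : ((PSdivSet α t R).card : ℝ) ≤ J.card := by exact_mod_cast hcard
  have hRp : 0 < R ^ ((1 : ℝ) / 2) := Real.rpow_pos_of_pos hR0 _
  have hRa : 0 < R ^ (1 / α) := Real.rpow_pos_of_pos hR0 _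
  have hq : 0 < R ^ (1 / α) / t := by positivity
  rcases lt_or_ge α 2 with h2 | h2
  · have h3 := core α hα h2 X hX1 t ht J hJ
    rw [← hK0, hXY] at h3
    have k1 : 6 * (X / t) ≤ K0 * (3 * (R ^ (1 / α) / t)) := by
      have e : X / t ≤ 3 * (R ^ (1 / α) / t) := by
        calc X / t ≤ (3 * R ^ (1 / α)) / t := by gcongr
          _ = _ := by ring
      calc 6 * (X / t) ≤ 6 * (3 * (R ^ (1 / α) / t)) := by gcongr
        _ ≤ _ := by gcongr
    have k2 : K0 * (3 * R) ^ ((1 : ℝ) / 2) ≤ K0 * (3 * R ^ ((1 : ℝ) / 2)) := by gcongr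
    linarith
  · have h3 : (J.card : ℝ) ≤ X := by
      have : J.card ≤ (Finset.Icc 1 ⌊X⌋₊).card := by
        apply Finset.card_le_card
        intro j hj
        exact Finset.mem_Icc.2 ⟨(hJ j hj).1, Nat.le_floor (hJ j hj).2.1⟩
      rw [Nat.card_Icc, Nat.add_sub_cancel] at this
      calc (J.card : ℝ) ≤ ⌊X⌋₊ := by exact_mod_cast this
        _ ≤ X := Nat.floor_le (by linarith)
    have h4 : X ≤ (3 * R) ^ ((1 : ℝ) / 2) := by
      rw [hX]
      apply Real.rpow_le_rpow_of_exponent_le (by linarith)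
      gcongr
    have k1 : 3 * R ^ ((1 : ℝ) / 2) ≤ 3 * K0 * (R ^ ((1 : ℝ) / 2)) := by nlinarith
    have k2 : 0 ≤ 3 * K0 * (R ^ (1 / α) / t) := by positivity
    linarith
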